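/- Let p ≥ 2 and n = 3p, and for i ∈ ℤ let ī denote the unique element of [n] with ī ≡ i (mod n). Let Σ = ⟨{ {ī, (i+p)¯, (i+2p)¯} : i=1,…,p }⟩, and for i=1,…,n and j=1,…,p−1 let Δ(i,j) = ⟨{ī, (i+p)¯, (i+j+p)¯}, {(i+j+p)¯, (i+j+2p)¯, ī}⟩. Set Δ̂ = Σ ∪ (⋃_{i,j} Δ(i,j)) and M = (1/3)·C(n−2,2). Then Δ̂ is Buchsbaum, link-acyclic, and h(Δ̂) = (1, n−3, 3M, −M). -/

import Mathlib

open Finset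

noncomputable section

/-- `Δ` is a simplicial complex on `[n] = {1,…,n}`: a collection of subsets of `[n]`,
closed under taking subsets, containing every singleton `{i}` for `i ∈ [n]`. -/
def IsComplexOn (n : ℕ) (Δ : Finset (Finset ℕ)) : Prop :=
  (∀ F ∈ Δ, ∀ G ⊆ F, G ∈ Δ) ∧
  (∀ F ∈ Δ, ∀ i ∈ F, i ∈ Finset.Icc 1 n) ∧
  (∀ i ∈ Finset.Icc 1 n, ({i} : Finset ℕ) ∈ Δ)

/-- a simplicial complex whose vertex set is contained in `[n]`:
a downward closed collection of subsets of `[n]`. -/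
def IsComplexIn (n : ℕ) (Δ : Finset (Finset ℕ)) : Prop :=
  (∀ F ∈ Δ, ∀ G ⊆ F, G ∈ Δ) ∧ (∀ F ∈ Δ, ∀ i ∈ F, i ∈ Finset.Icc 1 n)

/-- the faces of `Δ` with `m` vertices -/
def facesOf (Δ : Finset (Finset ℕ)) (m : ℕ) : Finset (Finset ℕ) :=
  Δ.filter fun F => F.card = m

/-- `fVec Δ j = f_{j-1}(Δ)`, the number of faces of `Δ` with `j` vertices;
by convention `f_{-1}(Δ) = 1`. -/
def fVec (Δ : Finset (Finset ℕ)) (j : ℕ) : ℤ :=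
  if j = 0 then 1 else ((facesOf Δ j).card : ℤ)

/-- the `h`-vector of a `(d-1)`-dimensional complex, defined by
`∑ f_{i-1} (x-1)^{d-i} = ∑ h_i x^{d-i}`, i.e.
`h_i = ∑_{j=0}^{i} (-1)^{i-j} C(d-j, i-j) f_{j-1}`. -/
def hVec (d : ℕ) (Δ : Finset (Finset ℕ)) (i : ℕ) : ℤ :=
  ∑ j ∈ Finset.range (i + 1),
    (-1 : ℤ) ^ (i - j) * ((d - j).choose (i - j) : ℤ) * fVec Δ j

/-- the dimension `max {k : f_k(Δ) ≠ 0}` of `Δ`, as an integer -/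
def dimZ (Δ : Finset (Finset ℕ)) : ℤ := ((Δ.sup Finset.card : ℕ) : ℤ) - 1

/-- the link `lk_Δ(F) = {G : G ∩ F = ∅, G ∪ F ∈ Δ}` -/
def link (Δ : Finset (Finset ℕ)) (F : Finset ℕ) : Finset (Finset ℕ) :=
  Δ.filter fun G => Disjoint G F ∧ G ∪ F ∈ Δ

variable (K : Type) [Field K]

/-- the simplicial boundary operator on formal `K`-linear combinations of
finite subsets of `ℕ` (vertices ordered by the order on `ℕ`):
`∂ F = ∑_{v ∈ F} (-1)^{#{u ∈ F : u < v}} (F \ {v})`. -/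
def bdry : (Finset ℕ →₀ K) →ₗ[K] (Finset ℕ →₀ K) :=
  Finsupp.lsum K fun F => LinearMap.toSpanSingleton K (Finset ℕ →₀ K)
    (∑ v ∈ F, ((-1 : K) ^ ((F.filter fun u => u < v).card)) • Finsupp.single (F.erase v) (1 : K))

/-- the space of simplicial `K`-chains of `Δ` spanned by the faces with `m` vertices
(for `m = 0` this is the span of the empty face, giving *reduced* homology) -/
def chains (Δ : Finset (Finset ℕ)) (m : ℕ) : Submodule K (Finset ℕ →₀ K) :=
  Submodule.span K ((fun F => Finsupp.single F (1 : K)) '' (facesOf Δ m : Set (Finset ℕ)))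

/-- the dimension of the reduced homology of `Δ` at faces of cardinality `m`:
`dim (ker ∂ ∩ C_m) - dim (∂ C_{m+1})` -/
def homDim (Δ : Finset (Finset ℕ)) (m : ℕ) : ℕ :=
  Module.finrank K ↥(chains K Δ m ⊓ LinearMap.ker (bdry K))
    - Module.finrank K ↥((chains K Δ (m + 1)).map (bdry K))

/-- the reduced Betti number `β_i(Δ; K) = dim_K H̃_i(Δ; K)` for `i : ℤ` -/
def betti (Δ : Finset (Finset ℕ)) (i : ℤ) : ℕ :=
  if 0 ≤ i + 1 then homDim K Δ (i + 1).toNat else 0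

/-- all facets (maximal faces) of `Δ` have the same cardinality -/
def IsPure (Δ : Finset (Finset ℕ)) : Prop :=
  ∀ F ∈ Δ, (∀ G ∈ Δ, F ⊆ G → F = G) → F.card = Δ.sup Finset.card

/-- `Δ` is Cohen–Macaulay (over `K`): for every face `F ∈ Δ` (including `∅`),
`β_i(lk_Δ(F)) = 0` for all `i ≠ dim Δ - |F|`. -/
def IsCohenMacaulay (Δ : Finset (Finset ℕ)) : Prop :=
  ∀ F ∈ Δ, ∀ i : ℤ, i ≠ dimZ Δ - F.card → betti K (link Δ F) i = 0

/-- `Δ` is Buchsbaum (over `K`): `Δ` is pure and the link of every vertex is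
Cohen–Macaulay. -/
def IsBuchsbaum (Δ : Finset (Finset ℕ)) : Prop :=
  IsPure Δ ∧ ∀ v : ℕ, ({v} : Finset ℕ) ∈ Δ → IsCohenMacaulay K (link Δ {v})

/-- `Δ` is connected: any two vertices are joined by a path of edges of `Δ` -/
def IsConnectedComplex (Δ : Finset (Finset ℕ)) : Prop :=
  ∀ u v : ℕ, ({u} : Finset ℕ) ∈ Δ → ({v} : Finset ℕ) ∈ Δ →
    Relation.ReflTransGen (fun a b : ℕ => a ≠ b ∧ ({a, b} : Finset ℕ) ∈ Δ) u v

/-- `Δ` is link-acyclic: `β_i(lk_Δ(v)) = 0` for every vertex `v` of `Δ` and every `i` -/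
def IsLinkAcyclic (Δ : Finset (Finset ℕ)) : Prop :=
  ∀ v : ℕ, ({v} : Finset ℕ) ∈ Δ → ∀ i : ℤ, betti K (link Δ {v}) i = 0

/-- `Δ` is `2`-dimensional with `h`-vector `(a, b, c, e)` -/
def hVector3 (Δ : Finset (Finset ℕ)) (a b c e : ℤ) : Prop :=
  hVec 3 Δ 0 = a ∧ hVec 3 Δ 1 = b ∧ hVec 3 Δ 2 = c ∧ hVec 3 Δ 3 = e

/-- `macaulay2 a = a^⟨2⟩`: if `a = C(b,2) + r` is the (greedy) `2`-nd Macaulay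
representation (`b` maximal with `C(b,2) ≤ a`, `0 ≤ r < b`, `r = C(r,1)`), then
`a^⟨2⟩ = C(b+1,3) + C(r+1,2)`, and `0^⟨2⟩ = 0`. -/
def macaulay2 (a : ℕ) : ℕ :=
  if a = 0 then 0
  else
    (Nat.findGreatest (fun t => t.choose 2 ≤ a) (a + 2) + 1).choose 3
      + (a - (Nat.findGreatest (fun t => t.choose 2 ≤ a) (a + 2)).choose 2 + 1).choose 2

/-- `modRep n i = ī`, the unique element of `[n] = {1,…,n}` congruent to `i` mod `n` -/
def modRep (n : ℕ) (i : ℤ) : ℕ := ((i - 1) % (n : ℤ)).toNat + 1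


/-- `Σ` for `n = 3p`: generated by `{ī, (i+p)¯, (i+2p)¯}`, `i = 1,…,p` -/
def SigmaB (p : ℕ) : Finset (Finset ℕ) :=
  (Finset.Icc 1 p).biUnion fun i =>
    ({modRep (3 * p) (i : ℤ), modRep (3 * p) ((i : ℤ) + p),
      modRep (3 * p) ((i : ℤ) + 2 * p)} : Finset ℕ).powerset

/-- `Δ(i,j)` for `n = 3p`: generated by `{ī, (i+p)¯, (i+j+p)¯}` and
`{(i+j+p)¯, (i+j+2p)¯, ī}` -/
def DeltaB (p i j : ℕ) : Finset (Finset ℕ) :=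
  ({modRep (3 * p) (i : ℤ), modRep (3 * p) ((i : ℤ) + p),
    modRep (3 * p) ((i : ℤ) + j + p)} : Finset ℕ).powerset ∪
  ({modRep (3 * p) ((i : ℤ) + j + p), modRep (3 * p) ((i : ℤ) + j + 2 * p),
    modRep (3 * p) (i : ℤ)} : Finset ℕ).powerset

/-- `Δ̂ = Σ ∪ ⋃_{i,j} Δ(i,j)` for `n = 3p` -/
def hatDeltaB (p : ℕ) : Finset (Finset ℕ) :=
  SigmaB p ∪ ((Finset.Icc 1 (3 * p)) ×ˢ (Finset.Icc 1 (p - 1))).biUnion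
    fun q => DeltaB p q.1 q.2

end

section Homology

variable (K : Type) [Field K]

lemma bdry_single (F : Finset ℕ) :
    bdry K (Finsupp.single F (1 : K)) =
      ∑ v ∈ F, ((-1 : K) ^ ((F.filter fun u => u < v).card)) •
        Finsupp.single (F.erase v) (1 : K) := by
  simp [bdry]

lemma bdry_single_singleton (a : ℕ) :
    bdry K (Finsupp.single {a} (1 : K)) = Finsupp.single ∅ (1 : K) := by
  rw [bdry_single]
  simp [Finset.filter_singleton]

lemma bdry_single_pair {a b : ℕ} (hab : a ≠ b) :
    ∃ ε : K, ε ≠ 0 ∧ bdry K (Finsupp.single {a, b} (1 : K)) =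
      ε • (Finsupp.single {b} (1 : K) - Finsupp.single {a} (1 : K)) := by
  wlog h : a < b generalizing a b
  · obtain ⟨ε, hε, he⟩ := this hab.symm (by omega)
    exact ⟨-ε, neg_ne_zero.2 hε, by rw [Finset.pair_comm, he]; module⟩
  refine ⟨1, one_ne_zero, ?_⟩
  have h1 : (({a, b} : Finset ℕ).filter fun u => u < a) = ∅ := by
    ext u; simp; omega
  have h2 : (({a, b} : Finset ℕ).filter fun u => u < b) = {a} := by
    ext u; simp; omega
  have h3 : ({a, b} : Finset ℕ).erase a = {b} := by ext u; simp; omega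
  have h4 : ({a, b} : Finset ℕ).erase b = {a} := by ext u; simp; omega
  rw [bdry_single, Finset.sum_pair hab, h1, h2, h3, h4]
  simp [sub_eq_add_neg]

lemma single_mem_chains {Δ : Finset (Finset ℕ)} {m : ℕ} {F : Finset ℕ}
    (hF : F ∈ Δ) (hm : F.card = m) : Finsupp.single F (1 : K) ∈ chains K Δ m :=
  Submodule.subset_span ⟨F, by simp [facesOf, hF, hm], rfl⟩

lemma chains_eq_bot {Δ : Finset (Finset ℕ)} {m : ℕ} (h : ∀ F ∈ Δ, F.card ≠ m) :
    chains K Δ m = ⊥ := by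
  have : facesOf Δ m = ∅ := by
    simpa [facesOf, Finset.filter_eq_empty_iff] using h
  simp [chains, this]

instance finiteDimensional_chains (Δ : Finset (Finset ℕ)) (m : ℕ) :
    FiniteDimensional K (chains K Δ m) :=
  FiniteDimensional.span_of_finite K ((facesOf Δ m).finite_toSet.image _)

lemma homDim_eq_zero {Δ : Finset (Finset ℕ)} {m : ℕ}
    (h : ∀ c ∈ chains K Δ m, bdry K c = 0 → c ∈ (chains K Δ (m + 1)).map (bdry K)) :
    homDim K Δ m = 0 := by
  refine Nat.sub_eq_zero_of_le (Submodule.finrank_mono ?_)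
  rintro c ⟨hc, hc0⟩
  exact h c hc hc0

lemma homDim_eq_zero_of_forall_card_ne {Δ : Finset (Finset ℕ)} {m : ℕ}
    (h : ∀ F ∈ Δ, F.card ≠ m) : homDim K Δ m = 0 := by
  refine homDim_eq_zero K fun c hc _ => ?_
  rw [chains_eq_bot K h, Submodule.mem_bot] at hc
  rw [hc]
  exact zero_mem _

lemma homDim_zero_eq_zero {Δ : Finset (Finset ℕ)} {a : ℕ} (ha : {a} ∈ Δ) :
    homDim K Δ 0 = 0 := by
  refine homDim_eq_zero K fun c hc _ => ?_
  refine (Submodule.span_le.2 ?_ : chains K Δ 0 ≤ _) hc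
  rintro _ ⟨F, hF, rfl⟩
  obtain rfl : F = ∅ := by simpa using (Finset.mem_filter.1 hF).2
  exact ⟨_, single_mem_chains K ha (by simp), bdry_single_singleton K a⟩

/-- `Γ` is the one-dimensional complex of a rooted tree with at least one edge: the nodes are
`φ t` for `t ∈ S`, the root is `φ r`, and the facets are the edges joining `φ t` to its parent
`φ (par t)`, where `par` decreases the depth `dep`. -/
structure IsRootedTree {ι : Type} (Γ : Finset (Finset ℕ)) (S : Finset ι) (r : ι) (φ : ι → ℕ)
    (par : ι → ι) (dep : ι → ℕ) : Prop where
  root_mem : r ∈ S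
  par_mem : ∀ t ∈ S, t ≠ r → par t ∈ S
  dep_par_lt : ∀ t ∈ S, t ≠ r → dep (par t) < dep t
  injOn : Set.InjOn φ S
  exists_ne : ∃ t ∈ S, t ≠ r
  mem_iff : ∀ G, G ∈ Γ ↔ ∃ t ∈ S, t ≠ r ∧ G ⊆ {φ t, φ (par t)}

namespace IsRootedTree

variable {ι : Type} {Γ : Finset (Finset ℕ)} {S : Finset ι} {r : ι} {φ : ι → ℕ}
  {par : ι → ι} {dep : ι → ℕ}

lemma ne_par (h : IsRootedTree Γ S r φ par dep) {t : ι} (ht : t ∈ S) (htr : t ≠ r) :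
    φ t ≠ φ (par t) := fun he => by
  have h1 := h.injOn ht (h.par_mem t ht htr) he
  have h2 := h.dep_par_lt t ht htr
  rw [← h1] at h2
  exact lt_irrefl _ h2

lemma card_edge (h : IsRootedTree Γ S r φ par dep) {t : ι} (ht : t ∈ S) (htr : t ≠ r) :
    ({φ t, φ (par t)} : Finset ℕ).card = 2 :=
  Finset.card_pair (h.ne_par ht htr)

lemma edge_mem (h : IsRootedTree Γ S r φ par dep) {t : ι} (ht : t ∈ S) (htr : t ≠ r) :
    ({φ t, φ (par t)} : Finset ℕ) ∈ Γ :=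
  (h.mem_iff _).2 ⟨t, ht, htr, subset_rfl⟩

lemma card_le (h : IsRootedTree Γ S r φ par dep) {G : Finset ℕ} (hG : G ∈ Γ) : G.card ≤ 2 := by
  obtain ⟨t, ht, htr, hsub⟩ := (h.mem_iff G).1 hG
  exact (Finset.card_le_card hsub).trans (h.card_edge ht htr).le

lemma eq_edge (h : IsRootedTree Γ S r φ par dep) {G : Finset ℕ} (hG : G ∈ Γ)
    (hc : G.card = 2) : ∃ t ∈ S, t ≠ r ∧ G = {φ t, φ (par t)} := by
  obtain ⟨t, ht, htr, hsub⟩ := (h.mem_iff G).1 hG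
  exact ⟨t, ht, htr, Finset.eq_of_subset_of_card_le hsub (by rw [h.card_edge ht htr, hc])⟩

lemma edge_injOn (h : IsRootedTree Γ S r φ par dep) {s t : ι} (hs : s ∈ S) (hsr : s ≠ r)
    (ht : t ∈ S) (htr : t ≠ r)
    (he : ({φ s, φ (par s)} : Finset ℕ) = {φ t, φ (par t)}) : s = t := by
  have h1 : φ s ∈ ({φ t, φ (par t)} : Finset ℕ) := he ▸ by simp
  have h2 : φ t ∈ ({φ s, φ (par s)} : Finset ℕ) := he ▸ by simp
  simp only [Finset.mem_insert, Finset.mem_singleton] at h1 h2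
  rcases h1 with h1 | h1
  · exact h.injOn hs ht h1
  rcases h2 with h2 | h2
  · exact (h.injOn ht hs h2).symm
  have e1 := h.injOn hs (h.par_mem t ht htr) h1
  have e2 := h.injOn ht (h.par_mem s hs hsr) h2
  have d1 := h.dep_par_lt t ht htr
  have d2 := h.dep_par_lt s hs hsr
  rw [← e1] at d1
  rw [← e2] at d2
  omega

lemma exists_edge_of_mem (h : IsRootedTree Γ S r φ par dep) {t : ι} (ht : t ∈ S) :
    ∃ s ∈ S, s ≠ r ∧ φ t ∈ ({φ s, φ (par s)} : Finset ℕ) := by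
  by_cases htr : t = r
  · subst htr
    obtain ⟨s, hsm, hmin⟩ : ∃ s ∈ {s ∈ (S : Set ι) | s ≠ t},
        ∀ u ∈ {s ∈ (S : Set ι) | s ≠ t}, dep s ≤ dep u := by
      obtain ⟨s, hs, hst⟩ := h.exists_ne
      exact Set.exists_min_image _ dep (S.finite_toSet.subset fun _ hx => hx.1) ⟨s, hs, hst⟩
    refine ⟨s, hsm.1, hsm.2, ?_⟩
    have : par s = t := by
      by_contra hne
      have h1 := hmin _ ⟨h.par_mem s hsm.1 hsm.2, hne⟩
      have h2 := h.dep_par_lt s hsm.1 hsm.2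
      omega
    simp [this]
  · exact ⟨t, ht, htr, by simp⟩

lemma singleton_mem (h : IsRootedTree Γ S r φ par dep) {t : ι} (ht : t ∈ S) :
    ({φ t} : Finset ℕ) ∈ Γ := by
  obtain ⟨s, hs, hsr, hsub⟩ := h.exists_edge_of_mem ht
  exact (h.mem_iff _).2 ⟨s, hs, hsr, by simpa using hsub⟩

lemma exists_eq_of_singleton_mem (h : IsRootedTree Γ S r φ par dep) {a : ℕ}
    (ha : ({a} : Finset ℕ) ∈ Γ) : ∃ t ∈ S, a = φ t := by
  obtain ⟨t, ht, htr, hsub⟩ := (h.mem_iff _).1 ha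
  simp only [Finset.singleton_subset_iff, Finset.mem_insert, Finset.mem_singleton] at hsub
  rcases hsub with e | e
  · exact ⟨t, ht, e⟩
  · exact ⟨_, h.par_mem t ht htr, e⟩

lemma single_sub_single_root_mem (h : IsRootedTree Γ S r φ par dep) (n : ℕ) :
    ∀ t ∈ S, dep t = n → Finsupp.single {φ t} (1 : K) - Finsupp.single {φ r} (1 : K) ∈
      (chains K Γ 2).map (bdry K) := by
  induction n using Nat.strong_induction_on with
  | _ n ih =>
    intro t ht hn
    by_cases htr : t = r
    · rw [htr, sub_self]
      exact zero_mem _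
    have h1 := ih _ (hn ▸ h.dep_par_lt t ht htr) _ (h.par_mem t ht htr) rfl
    obtain ⟨ε, hε, he⟩ := bdry_single_pair K (h.ne_par ht htr)
    have h2 : bdry K (Finsupp.single {φ t, φ (par t)} (1 : K)) ∈ (chains K Γ 2).map (bdry K) :=
      Submodule.mem_map_of_mem (single_mem_chains K (h.edge_mem ht htr) (h.card_edge ht htr))
    rw [he, Submodule.smul_mem_iff _ hε] at h2
    convert sub_mem h1 h2 using 1
    abel

lemma exists_sub_smul_mem (h : IsRootedTree Γ S r φ par dep) {c : Finset ℕ →₀ K}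
    (hc : c ∈ chains K Γ 1) : ∃ a : K,
      c - a • Finsupp.single {φ r} (1 : K) ∈ (chains K Γ 2).map (bdry K) ∧
      bdry K c = a • Finsupp.single ∅ (1 : K) := by
  induction hc using Submodule.span_induction with
  | mem x hx =>
    obtain ⟨F, hF, rfl⟩ := hx
    obtain ⟨hF, hc⟩ := Finset.mem_filter.1 hF
    obtain ⟨a, rfl⟩ := Finset.card_eq_one.1 hc
    obtain ⟨t, ht, rfl⟩ := h.exists_eq_of_singleton_mem hF
    exact ⟨1, by simpa using h.single_sub_single_root_mem K _ t ht rfl,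
      by simpa using bdry_single_singleton K (φ t)⟩
  | zero => exact ⟨0, by simp, by simp⟩
  | add x y _ _ hx hy =>
    obtain ⟨a, ha, ha'⟩ := hx
    obtain ⟨b, hb, hb'⟩ := hy
    refine ⟨a + b, ?_, by rw [map_add, ha', hb', add_smul]⟩
    convert add_mem ha hb using 1
    module
  | smul k x _ hx =>
    obtain ⟨a, ha, ha'⟩ := hx
    refine ⟨k * a, ?_, by rw [map_smul, ha', mul_smul]⟩
    convert Submodule.smul_mem _ k ha using 1
    module

lemma eq_zero_of_bdry_eq_zero (h : IsRootedTree Γ S r φ par dep) {c : Finset ℕ →₀ K}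
    (hc : c ∈ chains K Γ 2) (hb : bdry K c = 0) : c = 0 := by
  have hsupp : ∀ F ∈ c.support, F ∈ Γ ∧ F.card = 2 := by
    rw [chains, ← Finsupp.supported_eq_span_single] at hc
    intro F hF
    exact Finset.mem_filter.1 (hc hF)
  by_contra hne
  obtain ⟨t, ⟨ht, htr, hct⟩, hmax⟩ :
      ∃ t ∈ {t : ι | t ∈ S ∧ t ≠ r ∧ c {φ t, φ (par t)} ≠ 0},
        ∀ s ∈ {t : ι | t ∈ S ∧ t ≠ r ∧ c {φ t, φ (par t)} ≠ 0}, dep s ≤ dep t := by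
    refine Set.exists_max_image _ dep (S.finite_toSet.subset fun _ hx => hx.1) ?_
    obtain ⟨F, hF⟩ := Finsupp.support_nonempty_iff.2 hne
    obtain ⟨t, ht, htr, rfl⟩ := h.eq_edge (hsupp F hF).1 (hsupp F hF).2
    exact ⟨t, ht, htr, Finsupp.mem_support_iff.1 hF⟩
  have hexp : bdry K c = ∑ F ∈ c.support, c F • bdry K (Finsupp.single F (1 : K)) := by
    conv_lhs => rw [← Finsupp.sum_single c, Finsupp.sum, map_sum]
    refine Finset.sum_congr rfl fun F _ => ?_
    rw [← map_smul, Finsupp.smul_single, smul_eq_mul, mul_one]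
  have hval := DFunLike.congr_fun (hexp.symm.trans hb) {φ t}
  rw [Finsupp.finsetSum_apply, Finset.sum_eq_single ({φ t, φ (par t)} : Finset ℕ)] at hval
  · obtain ⟨ε, hε, he⟩ := bdry_single_pair K (h.ne_par ht htr)
    rw [he] at hval
    have := h.ne_par ht htr
    simp [hct, hε, this.symm] at hval
  · intro F hF hFt
    obtain ⟨s, hs, hsr, rfl⟩ := h.eq_edge (hsupp F hF).1 (hsupp F hF).2
    have hst : s ≠ t := fun e => hFt (by rw [e])
    have h1 : φ s ≠ φ t := fun e => hst (h.injOn hs ht e)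
    have h2 : φ (par s) ≠ φ t := fun e => by
      have e1 := h.injOn (h.par_mem s hs hsr) ht e
      have e2 := h.dep_par_lt s hs hsr
      have e3 := hmax s ⟨hs, hsr, Finsupp.mem_support_iff.1 hF⟩
      rw [e1] at e2
      omega
    obtain ⟨ε, hε, he⟩ := bdry_single_pair K (h.ne_par hs hsr)
    rw [he]
    simp [h1, h2]
  · intro hF
    rw [Finsupp.notMem_support_iff] at hF
    exact absurd hF hct

lemma homDim_eq_zero (h : IsRootedTree Γ S r φ par dep) (m : ℕ) : homDim K Γ m = 0 := by
  match m with
  | 0 => exact homDim_zero_eq_zero K (h.singleton_mem h.root_mem)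
  | 1 =>
    refine _root_.homDim_eq_zero K fun c hc hb => ?_
    obtain ⟨a, ha, ha'⟩ := h.exists_sub_smul_mem K hc
    have ha0 : a = 0 := by
      have := DFunLike.congr_fun (ha'.symm.trans hb) ∅
      simpa using this
    simpa [ha0] using ha
  | 2 =>
    refine _root_.homDim_eq_zero K fun c hc hb => ?_
    rw [h.eq_zero_of_bdry_eq_zero K hc hb]
    exact zero_mem _
  | m + 3 =>
    refine homDim_eq_zero_of_forall_card_ne K fun F hF hc => ?_
    have := h.card_le hF
    omega

lemma betti_eq_zero (h : IsRootedTree Γ S r φ par dep) (i : ℤ) : betti K Γ i = 0 := by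
  unfold betti
  split_ifs
  · exact h.homDim_eq_zero K _
  · rfl

lemma sup_card (h : IsRootedTree Γ S r φ par dep) : Γ.sup Finset.card = 2 := by
  refine le_antisymm (Finset.sup_le fun F hF => h.card_le hF) ?_
  obtain ⟨t, ht, htr⟩ := h.exists_ne
  have := Finset.le_sup (f := Finset.card) (h.edge_mem ht htr)
  rwa [h.card_edge ht htr] at this

lemma isCohenMacaulay (h : IsRootedTree Γ S r φ par dep) : IsCohenMacaulay K Γ := by
  intro F hF i hi
  rw [dimZ, h.sup_card] at hi
  rcases F.eq_empty_or_nonempty with rfl | hne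
  · have : link Γ ∅ = Γ := by
      ext G
      simp +contextual [link]
    rw [this]
    exact h.betti_eq_zero K i
  have hpos := hne.card_pos
  have hlink : ∀ G ∈ link Γ F, G.card + F.card ≤ 2 := by
    intro G hG
    obtain ⟨_, hd, hu⟩ := Finset.mem_filter.1 hG
    rw [← Finset.card_union_of_disjoint hd]
    exact h.card_le hu
  unfold betti
  split_ifs with hi0
  swap
  · rfl
  by_cases hcard : i + 1 = 0 ∧ F.card = 1
  · obtain ⟨a, rfl⟩ := Finset.card_eq_one.1 hcard.2
    obtain ⟨t, ht, rfl⟩ := h.exists_eq_of_singleton_mem hF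
    obtain ⟨s, hs, hsr, hst⟩ := h.exists_edge_of_mem ht
    have hmem := h.edge_mem hs hsr
    obtain ⟨b, hb⟩ : ∃ b, ({φ s, φ (par s)} : Finset ℕ).erase (φ t) = {b} := by
      rw [← Finset.card_eq_one, Finset.card_erase_of_mem hst, h.card_edge hs hsr]
    rw [hcard.1]
    refine homDim_zero_eq_zero K (a := b) (Finset.mem_filter.2 ⟨?_, ?_, ?_⟩)
    · rw [← hb]
      exact (h.mem_iff _).2 ⟨s, hs, hsr, Finset.erase_subset _ _⟩
    · rw [← hb]
      simp
    · rw [← hb, Finset.union_comm, ← Finset.insert_eq, Finset.insert_erase hst]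
      exact hmem
  · refine homDim_eq_zero_of_forall_card_ne K fun G hG hc => ?_
    have := hlink G hG
    omega

end IsRootedTree

end Homology

section Triangulation

lemma modRep_eq_iff {n : ℕ} (hn : 0 < n) (a b : ℤ) :
    modRep n a = modRep n b ↔ (n : ℤ) ∣ a - b := by
  have hn' : (n : ℤ) ≠ 0 := by exact_mod_cast hn.ne'
  have ha := Int.emod_nonneg (a - 1) hn'
  have hb := Int.emod_nonneg (b - 1) hn'
  have h1 : modRep n a = modRep n b ↔ (a - 1) % (n : ℤ) = (b - 1) % (n : ℤ) := by
    unfold modRep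
    omega
  rw [h1, Int.emod_eq_emod_iff_emod_sub_eq_zero, ← Int.dvd_iff_emod_eq_zero]
  ring_nf

lemma modRep_eq_of_sub_eq {n : ℕ} (hn : 0 < n) {a b : ℤ} (k : ℤ) (h : a - b = n * k) :
    modRep n a = modRep n b :=
  (modRep_eq_iff hn a b).2 ⟨k, h⟩

lemma eq_of_modRep_eq {n : ℕ} (hn : 0 < n) {a b : ℤ} (h : modRep n a = modRep n b)
    (hab : |a - b| < n) : a = b :=
  sub_eq_zero.1 (Int.eq_zero_of_abs_lt_dvd ((modRep_eq_iff hn a b).1 h) hab)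

lemma modRep_mem_Icc {n : ℕ} (hn : 0 < n) (a : ℤ) : modRep n a ∈ Finset.Icc 1 n := by
  have h1 := Int.emod_nonneg (a - 1) (show (n : ℤ) ≠ 0 by exact_mod_cast hn.ne')
  have h2 := Int.emod_lt_of_pos (a - 1) (show (0 : ℤ) < n by exact_mod_cast hn)
  rw [Finset.mem_Icc]
  unfold modRep
  omega

lemma modRep_of_mem_Icc {n v : ℕ} (hv : v ∈ Finset.Icc 1 n) : modRep n (v : ℤ) = v := by
  rw [Finset.mem_Icc] at hv
  unfold modRep
  rw [Int.emod_eq_of_lt (by omega) (by omega)]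
  omega

/-- The triangle `{ī, (i+p)¯, (i+p+j)¯}` modulo `3p`. -/
def cyclicTriangle (p : ℕ) (i j : ℤ) : Finset ℕ :=
  {modRep (3 * p) i, modRep (3 * p) (i + p), modRep (3 * p) (i + p + j)}

lemma cyclicTriangle_congr {p : ℕ} (hp : 0 < p) {a b : ℤ}
    (h : modRep (3 * p) a = modRep (3 * p) b) (j : ℤ) :
    cyclicTriangle p a j = cyclicTriangle p b j := by
  have hn : 0 < 3 * p := by omega
  have hd := (modRep_eq_iff hn a b).1 h
  have key : ∀ t : ℤ, modRep (3 * p) (a + t) = modRep (3 * p) (b + t) := fun t => by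
    rw [modRep_eq_iff hn]
    simpa using hd
  unfold cyclicTriangle
  rw [add_assoc, add_assoc b, key, key, h]

lemma cyclicTriangle_add_self {p : ℕ} (hp : 0 < p) (a : ℤ) :
    cyclicTriangle p (a + p) p = cyclicTriangle p a p := by
  have h : modRep (3 * p) (a + p + p + p) = modRep (3 * p) a :=
    modRep_eq_of_sub_eq (by omega) 1 (by push_cast; ring)
  unfold cyclicTriangle
  rw [h]
  ext x
  simp only [Finset.mem_insert, Finset.mem_singleton]
  tauto

lemma card_cyclicTriangle {p : ℕ} (hp : 0 < p) {i j : ℤ} (h1 : 1 ≤ j) (h2 : j ≤ p) :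
    (cyclicTriangle p i j).card = 3 := by
  have hn : 0 < 3 * p := by omega
  rw [Finset.card_eq_three]
  refine ⟨_, _, _, fun h => ?_, fun h => ?_, fun h => ?_, rfl⟩ <;>
  · have := eq_of_modRep_eq hn h (by rw [abs_lt]; push_cast; constructor <;> linarith)
    omega

lemma mem_hatDeltaB {p : ℕ} (hp : 0 < p) (F : Finset ℕ) :
    F ∈ hatDeltaB p ↔ ∃ i j : ℤ, 1 ≤ j ∧ j ≤ p ∧ F ⊆ cyclicTriangle p i j := by
  have hn : 0 < 3 * p := by omega
  constructor
  · intro hF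
    simp only [hatDeltaB, SigmaB, DeltaB, Finset.mem_union, Finset.mem_biUnion,
      Finset.mem_powerset, Finset.mem_product, Finset.mem_Icc] at hF
    rcases hF with ⟨i, hi, hF⟩ | ⟨⟨i, j⟩, ⟨hi, hj⟩, hF | hF⟩
    · refine ⟨i, p, by omega, le_rfl, ?_⟩
      rwa [cyclicTriangle, add_assoc (i : ℤ), ← two_mul]
    · refine ⟨i, j, by omega, by omega, ?_⟩
      rwa [cyclicTriangle, add_right_comm]
    · refine ⟨i + j + p, p - j, by omega, by omega, ?_⟩
      have h : modRep (3 * p) ((i : ℤ) + j + p + p + (p - j)) = modRep (3 * p) i :=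
        modRep_eq_of_sub_eq hn 1 (by push_cast; ring)
      rwa [cyclicTriangle, h, add_assoc ((i : ℤ) + j), ← two_mul]
  · rintro ⟨i, j, h1, h2, hF⟩
    have hi := modRep_mem_Icc hn i
    rw [← cyclicTriangle_congr hp (modRep_of_mem_Icc hi)] at hF
    generalize modRep (3 * p) i = k at hi hF
    rw [Finset.mem_Icc] at hi
    simp only [hatDeltaB, SigmaB, DeltaB, Finset.mem_union, Finset.mem_biUnion,
      Finset.mem_powerset, Finset.mem_product, Finset.mem_Icc]
    by_cases hj : j = p
    · left
      subst hj
      have hsub : ∀ l : ℕ, F ⊆ cyclicTriangle p l p →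
          F ⊆ {modRep (3 * p) (l : ℤ), modRep (3 * p) ((l : ℤ) + p),
            modRep (3 * p) ((l : ℤ) + 2 * p)} := fun l hl => by
        rwa [cyclicTriangle, add_assoc (l : ℤ), ← two_mul] at hl
      by_cases hk1 : k ≤ p
      · exact ⟨k, ⟨hi.1, hk1⟩, hsub k hF⟩
      by_cases hk2 : k ≤ 2 * p
      · refine ⟨k - p, by omega, hsub _ ?_⟩
        rwa [← cyclicTriangle_add_self hp, Nat.cast_sub (by omega), sub_add_cancel]
      · refine ⟨k - 2 * p, by omega, hsub _ ?_⟩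
        rw [← cyclicTriangle_add_self hp, ← cyclicTriangle_add_self hp,
          Nat.cast_sub (by omega)]
        convert hF using 2
        push_cast
        ring
    · right
      lift j to ℕ using by omega
      refine ⟨(k, j), ⟨hi, by omega, by omega⟩, Or.inl ?_⟩
      rwa [cyclicTriangle, add_right_comm] at hF

/-- Vertices of the link of a vertex `v` are written `(v+t)¯` with `1 ≤ t ≤ 3p - 1`. -/
def linkPoint (p : ℕ) (v : ℤ) (t : ℕ) : ℕ := modRep (3 * p) (v + t)

/-- The link of a vertex `v` is a tree rooted at `(v+p)¯`; this is the parent function. -/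
def linkParent (p t : ℕ) : ℕ := if t < p then 2 * p else if t ≤ 2 * p then p else t - p

/-- The depth function of the tree described by `linkParent`. -/
def linkDepth (p t : ℕ) : ℕ := if t = p then 0 else if p < t ∧ t ≤ 2 * p then 1 else 2

lemma linkPoint_injOn {p : ℕ} (hp : 0 < p) (v : ℤ) :
    Set.InjOn (linkPoint p v) (Finset.Icc 1 (3 * p - 1) : Finset ℕ) := by
  intro s hs t ht h
  simp only [Finset.coe_Icc, Set.mem_Icc] at hs ht
  have := eq_of_modRep_eq (by omega) h (by rw [abs_lt]; push_cast; constructor <;> omega)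
  omega

lemma linkPoint_ne {p : ℕ} (v : ℤ) {t : ℕ} (ht : t ∈ Finset.Icc 1 (3 * p - 1)) :
    linkPoint p v t ≠ modRep (3 * p) v := by
  rw [Finset.mem_Icc] at ht
  intro h
  have := eq_of_modRep_eq (by omega) h (by rw [abs_lt]; push_cast; constructor <;> omega)
  omega

lemma linkParent_mem {p t : ℕ} (hp : 0 < p) (ht : t ∈ Finset.Icc 1 (3 * p - 1)) :
    linkParent p t ∈ Finset.Icc 1 (3 * p - 1) := by
  rw [Finset.mem_Icc] at ht ⊢
  unfold linkParent
  split_ifs <;> omega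

lemma linkDepth_linkParent_lt {p t : ℕ} (ht : t ∈ Finset.Icc 1 (3 * p - 1)) (htp : t ≠ p) :
    linkDepth p (linkParent p t) < linkDepth p t := by
  rw [Finset.mem_Icc] at ht
  unfold linkParent linkDepth
  split_ifs <;> omega

/-- Every triangle of `Δ̂` through `v` is spanned by `v` and an edge of the tree. -/
lemma exists_cyclicTriangle_eq {p : ℕ} (hp : 0 < p) {v i j : ℤ} (h1 : 1 ≤ j) (h2 : j ≤ p)
    (hv : modRep (3 * p) v ∈ cyclicTriangle p i j) :
    ∃ t ∈ Finset.Icc 1 (3 * p - 1), t ≠ p ∧ cyclicTriangle p i j =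
      {modRep (3 * p) v, linkPoint p v t, linkPoint p v (linkParent p t)} := by
  have hn : 0 < 3 * p := by omega
  lift j to ℕ using by omega
  have hshift : ∀ a x y : ℤ, modRep (3 * p) v = modRep (3 * p) a → ((3 * p : ℕ) : ℤ) ∣ x - a - y →
      modRep (3 * p) x = modRep (3 * p) (v + y) := fun a x y h hd => by
    rw [modRep_eq_iff hn] at h ⊢
    have := dvd_sub hd h
    rwa [show x - a - y - (v - a) = x - (v + y) by ring] at this
  simp only [cyclicTriangle, Finset.mem_insert, Finset.mem_singleton] at hv
  rcases hv with hv | hv | hv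
  · refine ⟨p + j, by rw [Finset.mem_Icc]; omega, by omega, ?_⟩
    have e1 : linkParent p (p + j) = p := by grind [linkParent]
    rw [e1, cyclicTriangle, ← hv]
    unfold linkPoint
    rw [hshift _ (i + p) (p : ℕ) hv ⟨0, by push_cast; ring⟩,
      hshift _ (i + p + j) (p + j : ℕ) hv ⟨0, by push_cast; ring⟩]
    ext x
    simp only [Finset.mem_insert, Finset.mem_singleton]
    tauto
  · by_cases hj : j = p
    · subst hj
      refine ⟨2 * j, by rw [Finset.mem_Icc]; omega, by omega, ?_⟩
      have e1 : linkParent j (2 * j) = j := by grind [linkParent]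
      rw [e1, cyclicTriangle, ← hv]
      unfold linkPoint
      rw [hshift _ i (2 * j : ℕ) hv ⟨-1, by push_cast; ring⟩,
        hshift _ (i + j + j) (j : ℕ) hv ⟨0, by push_cast; ring⟩]
      ext x
      simp only [Finset.mem_insert, Finset.mem_singleton]
      tauto
    · refine ⟨j, by rw [Finset.mem_Icc]; omega, hj, ?_⟩
      have e1 : linkParent p j = 2 * p := by grind [linkParent]
      rw [e1, cyclicTriangle, ← hv]
      unfold linkPoint
      rw [hshift _ i (2 * p : ℕ) hv ⟨-1, by push_cast; ring⟩,
        hshift _ (i + p + j) (j : ℕ) hv ⟨0, by push_cast; ring⟩]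
      ext x
      simp only [Finset.mem_insert, Finset.mem_singleton]
      tauto
  · by_cases hj : j = p
    · subst hj
      refine ⟨2 * j, by rw [Finset.mem_Icc]; omega, by omega, ?_⟩
      have e1 : linkParent j (2 * j) = j := by grind [linkParent]
      rw [e1, cyclicTriangle, ← hv]
      unfold linkPoint
      rw [hshift _ i (j : ℕ) hv ⟨-1, by push_cast; ring⟩,
        hshift _ (i + j) (2 * j : ℕ) hv ⟨-1, by push_cast; ring⟩]
      ext x
      simp only [Finset.mem_insert, Finset.mem_singleton]
      tauto
    · refine ⟨3 * p - j, by rw [Finset.mem_Icc]; omega, by omega, ?_⟩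
      have e1 : linkParent p (3 * p - j) = 2 * p - j := by
        grind [linkParent]
      rw [e1, cyclicTriangle, ← hv]
      unfold linkPoint
      rw [hshift _ i (2 * p - j : ℕ) hv ⟨-1, by rw [Nat.cast_sub (by omega)]; push_cast; ring⟩,
        hshift _ (i + p) (3 * p - j : ℕ) hv
          ⟨-1, by rw [Nat.cast_sub (by omega)]; push_cast; ring⟩]
      ext x
      simp only [Finset.mem_insert, Finset.mem_singleton]
      tauto

/-- Every edge of the tree spans, together with `v`, a triangle of `Δ̂`. -/
lemma exists_eq_cyclicTriangle {p : ℕ} (v : ℤ) {t : ℕ}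
    (ht : t ∈ Finset.Icc 1 (3 * p - 1)) (htp : t ≠ p) : ∃ i j : ℤ, 1 ≤ j ∧ j ≤ p ∧
      ({modRep (3 * p) v, linkPoint p v t, linkPoint p v (linkParent p t)} : Finset ℕ) =
        cyclicTriangle p i j := by
  rw [Finset.mem_Icc] at ht
  have hn : 0 < 3 * p := by omega
  by_cases h1 : t < p
  · refine ⟨v - p, t, by omega, by omega, ?_⟩
    have e1 : linkParent p t = 2 * p := by grind [linkParent]
    unfold linkPoint
    rw [e1, cyclicTriangle, sub_add_cancel, modRep_eq_of_sub_eq hn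
      (a := v + (2 * p : ℕ)) (b := v - p) 1 (by push_cast; ring)]
    ext x
    simp only [Finset.mem_insert, Finset.mem_singleton]
    tauto
  by_cases h2 : t ≤ 2 * p
  · refine ⟨v, t - p, by omega, by omega, ?_⟩
    have e1 : linkParent p t = p := by grind [linkParent]
    unfold linkPoint
    rw [e1, cyclicTriangle, show v + (p : ℤ) + (t - p) = v + t by ring]
    ext x
    simp only [Finset.mem_insert, Finset.mem_singleton]
    tauto
  · refine ⟨v + t - 4 * p, 3 * p - t, by omega, by omega, ?_⟩
    have e1 : linkParent p t = t - p := by grind [linkParent]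
    unfold linkPoint
    rw [e1, cyclicTriangle, show v + (t : ℤ) - 4 * p + p + (3 * p - t) = v by ring,
      Nat.cast_sub (by omega),
      modRep_eq_of_sub_eq hn (a := v + t - 4 * p) (b := v + (t - p : ℤ)) (-1)
        (by push_cast; ring),
      modRep_eq_of_sub_eq hn (a := v + t - 4 * p + p) (b := v + t) (-1) (by push_cast; ring)]
    ext x
    simp only [Finset.mem_insert, Finset.mem_singleton]
    tauto

lemma hatDeltaB_mono {p : ℕ} (hp : 0 < p) {F G : Finset ℕ} (hF : F ∈ hatDeltaB p)
    (h : G ⊆ F) : G ∈ hatDeltaB p := by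
  rw [mem_hatDeltaB hp] at hF ⊢
  obtain ⟨i, j, h1, h2, hs⟩ := hF
  exact ⟨i, j, h1, h2, h.trans hs⟩

lemma isRootedTree_link {p : ℕ} (hp : 0 < p) (v : ℤ) :
    IsRootedTree (link (hatDeltaB p) {modRep (3 * p) v}) (Finset.Icc 1 (3 * p - 1)) p
      (linkPoint p v) (linkParent p) (linkDepth p) where
  root_mem := by rw [Finset.mem_Icc]; omega
  par_mem t ht _ := linkParent_mem hp ht
  dep_par_lt t ht htp := linkDepth_linkParent_lt ht htp
  injOn := linkPoint_injOn hp v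
  exists_ne := ⟨2 * p, by rw [Finset.mem_Icc]; omega, by omega⟩
  mem_iff G := by
    simp only [link, Finset.mem_filter, Finset.disjoint_singleton_right]
    constructor
    · rintro ⟨_, hvG, hu⟩
      obtain ⟨i, j, h1, h2, hs⟩ := (mem_hatDeltaB hp _).1 hu
      obtain ⟨t, ht, htp, he⟩ := exists_cyclicTriangle_eq hp h1 h2
        (hs (Finset.mem_union_right _ (Finset.mem_singleton_self _)))
      refine ⟨t, ht, htp, fun x hx => ?_⟩
      have hx' := hs (Finset.mem_union_left _ hx)
      rw [he, Finset.mem_insert] at hx'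
      exact hx'.resolve_left fun e => hvG (e ▸ hx)
    · rintro ⟨t, ht, htp, hs⟩
      obtain ⟨i, j, h1, h2, he⟩ := exists_eq_cyclicTriangle v ht htp
      have hu : G ∪ {modRep (3 * p) v} ∈ hatDeltaB p := by
        refine (mem_hatDeltaB hp _).2 ⟨i, j, h1, h2, ?_⟩
        rw [← he, Finset.union_comm, ← Finset.insert_eq]
        exact Finset.insert_subset_insert _ hs
      refine ⟨hatDeltaB_mono hp hu Finset.subset_union_left, fun hv => ?_, hu⟩
      have := hs hv
      rw [Finset.mem_insert, Finset.mem_singleton] at this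
      rcases this with e | e
      · exact linkPoint_ne v ht e.symm
      · exact linkPoint_ne v (linkParent_mem hp ht) e.symm

lemma subset_Icc_of_mem_hatDeltaB {p : ℕ} (hp : 0 < p) {F : Finset ℕ}
    (hF : F ∈ hatDeltaB p) : F ⊆ Finset.Icc 1 (3 * p) := by
  obtain ⟨i, j, _, _, hs⟩ := (mem_hatDeltaB hp _).1 hF
  refine hs.trans fun x hx => ?_
  simp only [cyclicTriangle, Finset.mem_insert, Finset.mem_singleton] at hx
  rcases hx with rfl | rfl | rfl <;> exact modRep_mem_Icc (by omega) _

lemma isRootedTree_link_of_mem {p v : ℕ} (hp : 0 < p) (hv : v ∈ Finset.Icc 1 (3 * p)) :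
    IsRootedTree (link (hatDeltaB p) {v}) (Finset.Icc 1 (3 * p - 1)) p
      (linkPoint p v) (linkParent p) (linkDepth p) := by
  have := isRootedTree_link hp v
  rwa [modRep_of_mem_Icc hv] at this

lemma isPure_hatDeltaB {p : ℕ} (hp : 0 < p) : IsPure (hatDeltaB p) := by
  have hmem : ∀ {i j : ℤ}, 1 ≤ j → j ≤ p → cyclicTriangle p i j ∈ hatDeltaB p :=
    fun h1 h2 => (mem_hatDeltaB hp _).2 ⟨_, _, h1, h2, subset_rfl⟩
  have hsup : (hatDeltaB p).sup Finset.card = 3 := by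
    refine le_antisymm (Finset.sup_le fun F hF => ?_) ?_
    · obtain ⟨i, j, h1, h2, hs⟩ := (mem_hatDeltaB hp _).1 hF
      exact (Finset.card_le_card hs).trans (card_cyclicTriangle hp h1 h2).le
    · have h1p : (1 : ℤ) ≤ p := by omega
      have := Finset.le_sup (f := Finset.card) (hmem (i := 0) le_rfl h1p)
      rwa [card_cyclicTriangle hp le_rfl h1p] at this
  intro F hF hmax
  obtain ⟨i, j, h1, h2, hs⟩ := (mem_hatDeltaB hp _).1 hF
  rw [hmax _ (hmem h1 h2) hs, hsup, card_cyclicTriangle hp h1 h2]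

lemma singleton_mem_hatDeltaB {p v : ℕ} (hp : 0 < p) (hv : v ∈ Finset.Icc 1 (3 * p)) :
    ({v} : Finset ℕ) ∈ hatDeltaB p := by
  refine (mem_hatDeltaB hp _).2 ⟨v, 1, le_rfl, by omega, ?_⟩
  rw [Finset.singleton_subset_iff, cyclicTriangle, modRep_of_mem_Icc hv]
  exact Finset.mem_insert_self _ _

lemma pair_mem_hatDeltaB {p a b : ℕ} (hp : 0 < p) (ha : a ∈ Finset.Icc 1 (3 * p))
    (hb : b ∈ Finset.Icc 1 (3 * p)) (hab : a ≠ b) : ({a, b} : Finset ℕ) ∈ hatDeltaB p := by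
  wlog h : a < b generalizing a b
  · rw [Finset.pair_comm]
    exact this hb ha hab.symm (by omega)
  have hbt : linkPoint p a (b - a) = b := by
    rw [linkPoint, Nat.cast_sub h.le, add_sub_cancel, modRep_of_mem_Icc hb]
  rw [Finset.mem_Icc] at hb
  have := (isRootedTree_link_of_mem hp ha).singleton_mem (t := b - a) (by
    rw [Finset.mem_Icc] at ha ⊢
    omega)
  rw [hbt] at this
  have h2 := (Finset.mem_filter.1 this).2.2
  rwa [Finset.union_comm, ← Finset.insert_eq] at h2

lemma card_facesOf_one {p : ℕ} (hp : 0 < p) : (facesOf (hatDeltaB p) 1).card = 3 * p := by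
  have : facesOf (hatDeltaB p) 1 = (Finset.Icc 1 (3 * p)).powersetCard 1 := by
    ext F
    simp only [facesOf, Finset.mem_filter, Finset.mem_powersetCard]
    refine ⟨fun h => ⟨subset_Icc_of_mem_hatDeltaB hp h.1, h.2⟩, fun h => ⟨?_, h.2⟩⟩
    obtain ⟨a, rfl⟩ := Finset.card_eq_one.1 h.2
    exact singleton_mem_hatDeltaB hp (by simpa using h.1)
  rw [this, Finset.card_powersetCard, Nat.card_Icc]
  simp

lemma card_facesOf_two {p : ℕ} (hp : 0 < p) :
    (facesOf (hatDeltaB p) 2).card = (3 * p).choose 2 := by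
  have : facesOf (hatDeltaB p) 2 = (Finset.Icc 1 (3 * p)).powersetCard 2 := by
    ext F
    simp only [facesOf, Finset.mem_filter, Finset.mem_powersetCard]
    refine ⟨fun h => ⟨subset_Icc_of_mem_hatDeltaB hp h.1, h.2⟩, fun h => ⟨?_, h.2⟩⟩
    obtain ⟨a, b, hab, rfl⟩ := Finset.card_eq_two.1 h.2
    exact pair_mem_hatDeltaB hp (h.1 (by simp)) (h.1 (by simp)) hab
  rw [this, Finset.card_powersetCard, Nat.card_Icc]
  simp

lemma card_filter_mem_facesOf_three {p v : ℕ} (hp : 0 < p) (hv : v ∈ Finset.Icc 1 (3 * p)) :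
    ((facesOf (hatDeltaB p) 3).filter fun F => v ∈ F).card = 3 * p - 2 := by
  have htree := isRootedTree_link_of_mem hp hv
  have hnot : ∀ t ∈ Finset.Icc 1 (3 * p - 1), t ≠ p →
      v ∉ ({linkPoint p v t, linkPoint p v (linkParent p t)} : Finset ℕ) := fun t ht htp => by
    simpa using (Finset.mem_filter.1 (htree.edge_mem ht htp)).2.1
  have hcard : ((Finset.Icc 1 (3 * p - 1)).erase p).card = 3 * p - 2 := by
    rw [Finset.card_erase_of_mem htree.root_mem, Nat.card_Icc]
    omega
  rw [← hcard]
  symm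
  refine Finset.card_bij
    (fun t _ => insert v {linkPoint p v t, linkPoint p v (linkParent p t)}) ?_ ?_ ?_
  · intro t ht
    obtain ⟨htp, ht⟩ := Finset.mem_erase.1 ht
    have h1 := (Finset.mem_filter.1 (htree.edge_mem ht htp)).2.2
    rw [Finset.union_comm, ← Finset.insert_eq] at h1
    refine Finset.mem_filter.2 ⟨Finset.mem_filter.2 ⟨h1, ?_⟩, Finset.mem_insert_self _ _⟩
    rw [Finset.card_insert_of_notMem (hnot t ht htp), htree.card_edge ht htp]
  · intro s hs t ht he
    obtain ⟨hsp, hs⟩ := Finset.mem_erase.1 hs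
    obtain ⟨htp, ht⟩ := Finset.mem_erase.1 ht
    refine htree.edge_injOn hs hsp ht htp ?_
    rw [← Finset.erase_insert (hnot s hs hsp), ← Finset.erase_insert (hnot t ht htp)]
    exact congrArg (fun F => Finset.erase F v) he
  · intro F hF
    obtain ⟨hF, hvF⟩ := Finset.mem_filter.1 hF
    obtain ⟨hF, hc⟩ := Finset.mem_filter.1 hF
    have hlink : F.erase v ∈ link (hatDeltaB p) {v} := by
      refine Finset.mem_filter.2 ⟨hatDeltaB_mono hp hF (Finset.erase_subset _ _), by simp, ?_⟩
      rwa [Finset.union_comm, ← Finset.insert_eq, Finset.insert_erase hvF]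
    obtain ⟨t, ht, htp, he⟩ := htree.eq_edge hlink (by rw [Finset.card_erase_of_mem hvF, hc])
    exact ⟨t, Finset.mem_erase.2 ⟨htp, ht⟩, by rw [← he, Finset.insert_erase hvF]⟩

lemma card_facesOf_three {p : ℕ} (hp : 0 < p) :
    (facesOf (hatDeltaB p) 3).card = p * (3 * p - 2) := by
  have h := Finset.sum_card_inter (s := Finset.Icc 1 (3 * p)) (B := facesOf (hatDeltaB p) 3)
    fun v hv => card_filter_mem_facesOf_three hp hv
  have h3 : ∀ F ∈ facesOf (hatDeltaB p) 3, (Finset.Icc 1 (3 * p) ∩ F).card = 3 := fun F hF => by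
    obtain ⟨hF, hc⟩ := Finset.mem_filter.1 hF
    rw [Finset.inter_eq_right.2 (subset_Icc_of_mem_hatDeltaB hp hF), hc]
  rw [Finset.sum_congr rfl h3, Finset.sum_const, Nat.card_Icc, smul_eq_mul] at h
  have : 3 * (facesOf (hatDeltaB p) 3).card = 3 * (p * (3 * p - 2)) := by
    rw [mul_comm, h]
    simp [mul_assoc]
  omega

lemma hVector3_hatDeltaB {p : ℕ} (hp : 0 < p) :
    hVector3 (hatDeltaB p) 1 (((3 * p : ℕ) : ℤ) - 3)
      (3 * (((3 * p - 2).choose 2 / 3 : ℕ) : ℤ)) (-(((3 * p - 2).choose 2 / 3 : ℕ) : ℤ)) := by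
  obtain ⟨q, rfl⟩ : ∃ q, p = q + 1 := ⟨p - 1, by omega⟩
  obtain ⟨m, hm⟩ : ∃ m, q * (3 * q + 1) = 2 * m := by
    rcases Nat.even_or_odd' q with ⟨k, rfl | rfl⟩
    · exact ⟨k * (3 * (2 * k) + 1), by ring⟩
    · exact ⟨(2 * k + 1) * (3 * k + 2), by ring⟩
  have h1 : (3 * (q + 1) - 2).choose 2 / 3 = m := by
    have : (3 * (q + 1) - 2).choose 2 = 3 * m := by
      rw [show 3 * (q + 1) - 2 = 3 * q + 1 by omega, Nat.choose_two_right,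
        show (3 * q + 1) * (3 * q + 1 - 1) = 2 * (3 * m) by
          rw [Nat.add_sub_cancel]; linarith]
      omega
    omega
  have h2 : (3 * (q + 1)).choose 2 = 3 * m + 6 * q + 3 := by
    rw [Nat.choose_two_right, show 3 * (q + 1) * (3 * (q + 1) - 1) =
      2 * (3 * m + 6 * q + 3) by
        rw [show 3 * (q + 1) - 1 = 3 * q + 2 by omega]; linarith]
    omega
  have h3 : (q + 1) * (3 * (q + 1) - 2) = 2 * m + 3 * q + 1 := by
    rw [show 3 * (q + 1) - 2 = 3 * q + 1 by omega]
    linarith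
  rw [h1]
  refine ⟨?_, ?_, ?_, ?_⟩ <;>
  · simp [hVec, fVec, Finset.sum_range_succ, card_facesOf_one hp, card_facesOf_two hp,
      card_facesOf_three hp, h2, h3]
    try ring

end Triangulation

/-- **Lemma 3.5(i)** (Hanano). For `n = 3p`, `Δ̂` is Buchsbaum, link-acyclic and
`h(Δ̂) = (1, n-3, 3M, -M)` where `M = C(n-2,2)/3`. -/
theorem stmt15 (K : Type) [Field K] (p : ℕ) (hp : 2 ≤ p) :
    IsBuchsbaum K (hatDeltaB p) ∧ IsLinkAcyclic K (hatDeltaB p) ∧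
      hVector3 (hatDeltaB p) 1 (((3 * p : ℕ) : ℤ) - 3)
        (3 * (((3 * p - 2).choose 2 / 3 : ℕ) : ℤ)) (-(((3 * p - 2).choose 2 / 3 : ℕ) : ℤ)) := by
  have hp0 : 0 < p := by omega
  have htree := fun (v : ℕ) (hv : ({v} : Finset ℕ) ∈ hatDeltaB p) =>
    isRootedTree_link_of_mem hp0
      (Finset.singleton_subset_iff.1 (subset_Icc_of_mem_hatDeltaB hp0 hv))
  exact ⟨⟨isPure_hatDeltaB hp0, fun v hv => (htree v hv).isCohenMacaulay K⟩,
    fun v hv i => (htree v hv).betti_eq_zero K i, hVector3_hatDeltaB hp0⟩
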